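/- Consider the DGL-based classification setup with M ≥ 2 hypotheses over a finite alphabet 𝒳, test sequence length n, and training sequence length N = nα for α > 0. Suppose v > 0 is such that almost surely min_{i ≠ j} V(T_i, T_j) ≥ v, where T_1,…,T_M are the (random) empirical distributions of the training sequences. Then the classification error probability satisfies Pr[e_CL] ≤ 2M · exp(−n( 2α v² / (|𝒳| + 2√α)² − max{ 2·ln(M−1)/n , ln|𝒳| / n } )). -/

import Mathlib

open MeasureTheory ProbabilityTheory

/-- Total variation distance between two probability mass functions on a
finite alphabet: `V(P,Q) = (1/2) * ∑ a, |P a - Q a|`. -/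
noncomputable def tvDist {𝒳 : Type*} [Fintype 𝒳] (P Q : 𝒳 → ℝ) : ℝ :=
  (1 / 2) * ∑ a, |P a - Q a|

/-- Minimum of `tvDist (Q i) (Q j)` over all ordered pairs of distinct indices. -/
noncomputable def minPairTV {𝒳 : Type*} [Fintype 𝒳] {M : ℕ} (Q : Fin M → 𝒳 → ℝ) : ℝ :=
  sInf {x | ∃ i j : Fin M, i ≠ j ∧ x = tvDist (Q i) (Q j)}

/-- Empirical distribution of a sample `x : Fin N → 𝒳`:
`T a = (1/N) * #{k : x k = a}`. -/
noncomputable def empDist {𝒳 : Type*} [Fintype 𝒳] [DecidableEq 𝒳] {N : ℕ}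
    (x : Fin N → 𝒳) : 𝒳 → ℝ :=
  fun a => ((Finset.univ.filter fun k => x k = a).card : ℝ) / N

/-- The DGL statistic of hypothesis `i`: the maximum over the sets
`A_{p,q} = {a : T q a ≤ T p a}` (for `p < q`) of `|T_i(A) - ν(A)|`. -/
noncomputable def dglScore {𝒳 : Type*} [Fintype 𝒳] {M : ℕ}
    (T : Fin M → 𝒳 → ℝ) (ν : 𝒳 → ℝ) (i : Fin M) : ℝ :=
  sSup {x | ∃ p q : Fin M, p < q ∧
    x = |(∑ a ∈ Finset.univ.filter fun a => T q a ≤ T p a, T i a) -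
         (∑ a ∈ Finset.univ.filter fun a => T q a ≤ T p a, ν a)|}

/-- The DGL test: accept the smallest hypothesis index minimizing the DGL statistic. -/
noncomputable def dglClassify {𝒳 : Type*} [Fintype 𝒳] {M : ℕ} (hM : 0 < M)
    (T : Fin M → 𝒳 → ℝ) (ν : 𝒳 → ℝ) : Fin M :=
  (Finset.univ.filter fun i => ∀ j, dglScore T ν i ≤ dglScore T ν j).min' (by
    obtain ⟨i, -, hi⟩ := Finset.exists_min_image Finset.univ (dglScore T ν)
      ⟨⟨0, hM⟩, Finset.mem_univ _⟩
    exact ⟨i, Finset.mem_filter.mpr ⟨Finset.mem_univ _, fun j => hi j (Finset.mem_univ _)⟩⟩)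

/-- The discrete measure on `𝒳` whose mass at `a` is `P a`. -/
noncomputable def measOf {𝒳 : Type*} [Fintype 𝒳] [MeasurableSpace 𝒳] (P : 𝒳 → ℝ) :
    Measure 𝒳 :=
  ∑ a, ENNReal.ofReal (P a) • Measure.dirac a

/-- The joint law of the DGL-based classification experiment on the sample space
`(training sequences) × (true hypothesis index) × (test sequence)`:
the `M` training sequences of length `N` are i.i.d. from `P 1, …, P M` respectively
and mutually independent, the hypothesis index `J` is uniform on `Fin M` and
independent of the training data, and given `J = j` the test sequence of length `n`
is i.i.d. from `P j`. -/
noncomputable def classMeasure {𝒳 : Type*} [Fintype 𝒳] [MeasurableSpace 𝒳]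
    {M N n : ℕ} (P : Fin M → 𝒳 → ℝ) :
    Measure ((Fin M → Fin N → 𝒳) × Fin M × (Fin n → 𝒳)) :=
  (M : ENNReal)⁻¹ • ∑ j : Fin M,
    (Measure.pi fun i => Measure.pi fun _ : Fin N => measOf (P i)).prod
      ((Measure.dirac j).prod (Measure.pi fun _ : Fin n => measOf (P j)))

/-- The classification-error event: the DGL test applied with the empirical training
distributions as nominal distributions outputs an index different from the true one. -/
def errEvent {𝒳 : Type*} [Fintype 𝒳] [DecidableEq 𝒳] {M N n : ℕ} (hM : 0 < M) :
    Set ((Fin M → Fin N → 𝒳) × Fin M × (Fin n → 𝒳)) :=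
  {ω | dglClassify hM (fun i => empDist (ω.1 i)) (empDist ω.2.2) ≠ ω.2.1}

lemma tv_eq {𝒳 : Type*} [Fintype 𝒳] (P Q : 𝒳 → ℝ) (h : ∑ a, P a = ∑ a, Q a) :
    tvDist P Q = (∑ a ∈ Finset.univ.filter fun a => Q a ≤ P a, P a) -
      (∑ a ∈ Finset.univ.filter fun a => Q a ≤ P a, Q a) := by
  unfold tvDist
  have h1 : ∑ a, |P a - Q a| = 2 * (∑ a ∈ Finset.univ.filter fun a => Q a ≤ P a, (P a - Q a))
      - ∑ a, (P a - Q a) := by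
    rw [Finset.sum_filter, Finset.mul_sum, ← Finset.sum_sub_distrib]
    refine Finset.sum_congr rfl fun a _ => ?_
    split_ifs with hh
    · rw [abs_of_nonneg (by linarith)]; ring
    · rw [abs_of_neg (by linarith)]; ring
  rw [h1, Finset.sum_sub_distrib, Finset.sum_sub_distrib, h]; ring

lemma abs_le_tv {𝒳 : Type*} [Fintype 𝒳] [DecidableEq 𝒳] (P Q : 𝒳 → ℝ)
    (h : ∑ a, P a = ∑ a, Q a) (A : Finset 𝒳) :
    |(∑ a ∈ A, P a) - (∑ a ∈ A, Q a)| ≤ tvDist P Q := by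
  unfold tvDist
  have h0 : ∑ a, (P a - Q a) = 0 := by rw [Finset.sum_sub_distrib, h]; ring
  have h1 := Finset.sum_add_sum_compl A (fun a => P a - Q a)
  have h3 := Finset.sum_add_sum_compl A (fun a => |P a - Q a|)
  have h4 := Finset.abs_sum_le_sum_abs (fun a => P a - Q a) A
  have h5 := Finset.abs_sum_le_sum_abs (fun a => P a - Q a) Aᶜ
  rw [h0] at h1
  have h6 : ∑ a ∈ Aᶜ, (P a - Q a) = -∑ a ∈ A, (P a - Q a) := by linarith
  rw [h6, abs_neg] at h5
  rw [← Finset.sum_sub_distrib]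
  linarith

lemma tv_comm {𝒳 : Type*} [Fintype 𝒳] (P Q : 𝒳 → ℝ) : tvDist P Q = tvDist Q P := by
  unfold tvDist
  simp_rw [abs_sub_comm]

lemma score_finite {𝒳 : Type*} [Fintype 𝒳] {M : ℕ}
    (T : Fin M → 𝒳 → ℝ) (ν : 𝒳 → ℝ) (i : Fin M) :
    Set.Finite {x | ∃ p q : Fin M, p < q ∧
    x = |(∑ a ∈ Finset.univ.filter fun a => T q a ≤ T p a, T i a) -
         (∑ a ∈ Finset.univ.filter fun a => T q a ≤ T p a, ν a)|} := by
  refine (Set.finite_range (fun pq : Fin M × Fin M =>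
    |(∑ a ∈ Finset.univ.filter fun a => T pq.2 a ≤ T pq.1 a, T i a) -
         (∑ a ∈ Finset.univ.filter fun a => T pq.2 a ≤ T pq.1 a, ν a)|)).subset ?_
  rintro x ⟨p, q, _, rfl⟩
  exact ⟨(p, q), rfl⟩

lemma le_score {𝒳 : Type*} [Fintype 𝒳] {M : ℕ}
    (T : Fin M → 𝒳 → ℝ) (ν : 𝒳 → ℝ) (i p q : Fin M) (h : p < q) :
    |(∑ a ∈ Finset.univ.filter fun a => T q a ≤ T p a, T i a) -
         (∑ a ∈ Finset.univ.filter fun a => T q a ≤ T p a, ν a)| ≤ dglScore T ν i :=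
  le_csSup (score_finite T ν i).bddAbove ⟨p, q, h, rfl⟩

lemma exists_score {𝒳 : Type*} [Fintype 𝒳] {M : ℕ} (hM : 2 ≤ M)
    (T : Fin M → 𝒳 → ℝ) (ν : 𝒳 → ℝ) (i : Fin M) :
    ∃ p q : Fin M, p < q ∧ dglScore T ν i =
      |(∑ a ∈ Finset.univ.filter fun a => T q a ≤ T p a, T i a) -
         (∑ a ∈ Finset.univ.filter fun a => T q a ≤ T p a, ν a)| :=
  Set.Nonempty.csSup_mem (s := {x | ∃ p q : Fin M, p < q ∧
    x = |(∑ a ∈ Finset.univ.filter fun a => T q a ≤ T p a, T i a) -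
         (∑ a ∈ Finset.univ.filter fun a => T q a ≤ T p a, ν a)|})
    ⟨_, ⟨0, by omega⟩, ⟨1, by omega⟩, by simp, rfl⟩ (score_finite T ν i)

lemma tv_le_scores {𝒳 : Type*} [Fintype 𝒳] {M : ℕ}
    (T : Fin M → 𝒳 → ℝ) (hT : ∀ i, ∑ a, T i a = 1) (ν : 𝒳 → ℝ) (i j : Fin M) (h : i ≠ j) :
    tvDist (T i) (T j) ≤ dglScore T ν i + dglScore T ν j := by
  wlog hij : i < j generalizing i j
  · rw [tv_comm, add_comm]
    exact this j i h.symm (lt_of_le_of_ne (not_lt.mp hij) h.symm)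
  rw [tv_eq _ _ (by rw [hT, hT])]
  have h1 := (abs_le.mp (le_score T ν i i j hij)).2
  have h2 := (abs_le.mp (le_score T ν j i j hij)).1
  linarith

lemma minPair_le {𝒳 : Type*} [Fintype 𝒳] {M : ℕ} (Q : Fin M → 𝒳 → ℝ) (i j : Fin M)
    (h : i ≠ j) : minPairTV Q ≤ tvDist (Q i) (Q j) := by
  refine csInf_le ⟨0, ?_⟩ ⟨i, j, h, rfl⟩
  rintro x ⟨i, j, _, rfl⟩
  unfold tvDist
  positivity

lemma classify_min {𝒳 : Type*} [Fintype 𝒳] {M : ℕ} (hM : 0 < M)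
    (T : Fin M → 𝒳 → ℝ) (ν : 𝒳 → ℝ) (j : Fin M) :
    dglScore T ν (dglClassify hM T ν) ≤ dglScore T ν j := by
  have := Finset.min'_mem (Finset.univ.filter fun i => ∀ j, dglScore T ν i ≤ dglScore T ν j) (by
    obtain ⟨i, -, hi⟩ := Finset.exists_min_image Finset.univ (dglScore T ν)
      ⟨⟨0, hM⟩, Finset.mem_univ _⟩
    exact ⟨i, Finset.mem_filter.mpr ⟨Finset.mem_univ _, fun j => hi j (Finset.mem_univ _)⟩⟩)
  exact (Finset.mem_filter.mp this).2 j

/-- Deterministic part. -/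
lemma err_imp {𝒳 : Type*} [Fintype 𝒳] [DecidableEq 𝒳] {M : ℕ} (hM : 2 ≤ M) (hM0 : 0 < M)
    (T : Fin M → 𝒳 → ℝ) (hT : ∀ i, ∑ a, T i a = 1) (ν : 𝒳 → ℝ) (j : Fin M)
    (P : 𝒳 → ℝ) (hP : ∑ a, P a = 1) (v ε δ : ℝ) (hv : v ≤ minPairTV T) (hed : ε + δ = v / 2)
    (herr : dglClassify hM0 T ν ≠ j) :
    (∃ a, 2 * ε / Fintype.card 𝒳 ≤ |(∑ b ∈ {a}, T j b) - ∑ b ∈ {a}, P b|) ∨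
    (∃ p q : Fin M, p < q ∧
      δ ≤ |(∑ a ∈ Finset.univ.filter fun a => T q a ≤ T p a, ν a) -
         (∑ a ∈ Finset.univ.filter fun a => T q a ≤ T p a, P a)|) := by
  have h1 := tv_le_scores T hT ν _ _ herr
  have h2 := minPair_le T _ _ herr
  have h3 := classify_min hM0 T ν j
  obtain ⟨p, q, hpq, h4⟩ := exists_score hM T ν j
  by_cases hc : ε ≤ tvDist (T j) P
  · left
    by_contra! hcon
    have hne : (Finset.univ : Finset 𝒳).Nonempty := by
      by_contra hne
      rw [Finset.not_nonempty_iff_eq_empty] at hne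
      rw [hne] at hP
      simp at hP
    have hK : (0 : ℝ) < Fintype.card 𝒳 := by
      exact_mod_cast Finset.card_pos.mpr hne
    have : ∑ a, |T j a - P a| < ∑ a : 𝒳, 2 * ε / Fintype.card 𝒳 :=
      Finset.sum_lt_sum_of_nonempty hne fun a _ => by simpa using hcon a
    rw [Finset.sum_const, Finset.card_univ, nsmul_eq_mul, mul_div_cancel₀ _ hK.ne'] at this
    unfold tvDist at hc
    linarith
  · right
    refine ⟨p, q, hpq, ?_⟩
    have h5 := abs_le_tv (T j) P (by rw [hT, hP]) (Finset.univ.filter fun a => T q a ≤ T p a)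
    have h6 := abs_sub_le (∑ a ∈ Finset.univ.filter fun a => T q a ≤ T p a, T j a)
      (∑ a ∈ Finset.univ.filter fun a => T q a ≤ T p a, P a)
      (∑ a ∈ Finset.univ.filter fun a => T q a ≤ T p a, ν a)
    rw [abs_sub_comm (∑ a ∈ Finset.univ.filter fun a => T q a ≤ T p a, ν a)]
    linarith

lemma sum_emp {𝒳 : Type*} [Fintype 𝒳] [DecidableEq 𝒳] {N : ℕ} (x : Fin N → 𝒳) (A : Finset 𝒳) :
    ∑ a ∈ A, empDist x a = (∑ k, if x k ∈ A then (1 : ℝ) else 0) / N := by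
  unfold empDist
  rw [← Finset.sum_div]
  congr 1
  simp_rw [Finset.card_filter]
  push_cast
  rw [Finset.sum_comm]
  refine Finset.sum_congr rfl fun k _ => ?_
  simp

lemma sum_emp_univ {𝒳 : Type*} [Fintype 𝒳] [DecidableEq 𝒳] {N : ℕ} (hN : 0 < N)
    (x : Fin N → 𝒳) : ∑ a, empDist x a = 1 := by
  rw [sum_emp]
  have : (N : ℝ) ≠ 0 := by positivity
  simp [this]

lemma measOf_prob {𝒳 : Type*} [Fintype 𝒳] [MeasurableSpace 𝒳] (P : 𝒳 → ℝ)
    (h0 : ∀ a, 0 ≤ P a) (h1 : ∑ a, P a = 1) : IsProbabilityMeasure (measOf P) := by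
  constructor
  unfold measOf
  simp [Measure.finsetSum_apply]
  rw [← ENNReal.ofReal_sum_of_nonneg (fun a _ => h0 a), h1, ENNReal.ofReal_one]

lemma measOf_integral {𝒳 : Type*} [Fintype 𝒳] [DecidableEq 𝒳] [MeasurableSpace 𝒳]
    [MeasurableSingletonClass 𝒳] (P : 𝒳 → ℝ)
    (h0 : ∀ a, 0 ≤ P a) (A : Finset 𝒳) :
    ∫ x, (if x ∈ A then (1 : ℝ) else 0) ∂(measOf P) = ∑ a ∈ A, P a := by
  unfold measOf
  rw [integral_finsetSum_measure (fun a _ => ?_)]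
  · simp [integral_smul_measure, ENNReal.toReal_ofReal, h0]
  · exact (integrable_dirac (by simp)).smul_measure (by simp)

lemma meas_all {Ω : Type*} [Finite Ω] [MeasurableSpace Ω] [MeasurableSingletonClass Ω]
    (s : Set Ω) : MeasurableSet s := s.toFinite.measurableSet

lemma hoeff {𝒳 : Type*} [Fintype 𝒳] [DecidableEq 𝒳] [MeasurableSpace 𝒳]
    [MeasurableSingletonClass 𝒳] (P : 𝒳 → ℝ)
    (h0 : ∀ a, 0 ≤ P a) (h1 : ∑ a, P a = 1) {n : ℕ} (hn : 0 < n) (A : Finset 𝒳) (t : ℝ)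
    (ht : 0 ≤ t) :
    (Measure.pi fun _ : Fin n => measOf P)
      {x | t ≤ |(∑ a ∈ A, empDist x a) - ∑ a ∈ A, P a|} ≤
      ENNReal.ofReal (2 * Real.exp (-2 * n * t ^ 2)) := by
  have := measOf_prob P h0 h1
  have hn' : (0 : ℝ) < n := by exact_mod_cast hn
  set μ := Measure.pi fun _ : Fin n => measOf P with hμ
  set f : 𝒳 → ℝ := fun x => (if x ∈ A then (1 : ℝ) else 0) with hf
  have hfm : Measurable f := fun s _ => meas_all _
  have hint : ∀ k : Fin n, ∫ x, f (x k) ∂μ = ∑ a ∈ A, P a := fun k => by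
    rw [hμ, integral_comp_eval (μ := fun _ : Fin n => measOf P) (i := k) (f := f)
      hfm.aestronglyMeasurable]
    exact measOf_integral P h0 A
  have hsub : ∀ k : Fin n, HasSubgaussianMGF (fun x : Fin n → 𝒳 => f (x k) - ∑ a ∈ A, P a)
      ((‖(1 : ℝ) - 0‖₊ / 2) ^ 2) μ := fun k => by
    have := hasSubgaussianMGF_of_mem_Icc (μ := μ) (X := fun x : Fin n → 𝒳 => f (x k))
      (a := 0) (b := 1) (hfm.comp (measurable_pi_apply k)).aemeasurable
      (Filter.Eventually.of_forall fun x => by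
        simp only [hf]; split_ifs <;> simp)
    rwa [hint] at this
  have hind : iIndepFun (fun (k : Fin n) (x : Fin n → 𝒳) => f (x k) - ∑ a ∈ A, P a) μ :=
    iIndepFun_pi (μ := fun _ : Fin n => measOf P)
      (X := fun _ y => f y - ∑ a ∈ A, P a) fun _ => (hfm.sub_const _).aemeasurable
  have hind2 : iIndepFun (fun (k : Fin n) (x : Fin n → 𝒳) => -(f (x k) - ∑ a ∈ A, P a)) μ :=
    iIndepFun_pi (μ := fun _ : Fin n => measOf P)
      (X := fun _ y => -(f y - ∑ a ∈ A, P a)) fun _ => (hfm.sub_const _).neg.aemeasurable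
  have hnt : 0 ≤ n * t := by positivity
  have e1 := HasSubgaussianMGF.measure_sum_ge_le_of_iIndepFun hind (s := Finset.univ)
    (fun k _ => hsub k) hnt
  have e2 := HasSubgaussianMGF.measure_sum_ge_le_of_iIndepFun hind2 (s := Finset.univ)
    (fun k _ => (hsub k).neg) hnt
  have hexp : -(n * t) ^ 2 / (2 * ((∑ _k : Fin n, ((‖(1 : ℝ) - 0‖₊ / 2) ^ 2 : NNReal) : NNReal) : ℝ))
      = -2 * n * t ^ 2 := by
    simp
    field_simp
  rw [hexp] at e1 e2
  have hsubset : {x : Fin n → 𝒳 | t ≤ |(∑ a ∈ A, empDist x a) - ∑ a ∈ A, P a|} ⊆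
      {x | n * t ≤ ∑ k, (f (x k) - ∑ a ∈ A, P a)} ∪
      {x | n * t ≤ ∑ k, -(f (x k) - ∑ a ∈ A, P a)} := by
    intro x hx
    simp only [Set.mem_ofPred_eq, Set.mem_union] at hx ⊢
    have hs : ∑ k, (f (x k) - ∑ a ∈ A, P a) = n * ((∑ a ∈ A, empDist x a) - ∑ a ∈ A, P a) := by
      rw [sum_emp, Finset.sum_sub_distrib]
      simp only [hf, Finset.sum_const, Finset.card_univ, Fintype.card_fin, nsmul_eq_mul]
      field_simp
    rw [Finset.sum_neg_distrib, hs, ← mul_neg]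
    rcases le_abs.mp hx with h | h
    · left; gcongr
    · right; gcongr
  rw [ENNReal.le_ofReal_iff_toReal_le (measure_ne_top _ _) (by positivity)]
  calc μ.real _ ≤ _ := measureReal_mono hsubset
    _ ≤ _ := measureReal_union_le _ _
    _ ≤ _ := by linarith

lemma prod_le_const {α β : Type*} [MeasurableSpace α] [MeasurableSpace β] (μ : Measure α)
    (ν : Measure β) [IsProbabilityMeasure μ] [SFinite ν] (S : Set (α × β)) (hS : MeasurableSet S)
    (c : ENNReal) (h : ∀ x, ν (Prod.mk x ⁻¹' S) ≤ c) : μ.prod ν S ≤ c := by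
  rw [Measure.prod_apply hS]
  calc _ ≤ ∫⁻ _, c ∂μ := lintegral_mono h
    _ = c := by simp

lemma card_lt_pairs (M : ℕ) :
    2 * (Finset.univ.filter fun p : Fin M × Fin M => p.1 < p.2).card = M * (M - 1) := by
  have h1 : (Finset.univ.filter fun p : Fin M × Fin M => p.1 < p.2).card =
      (Finset.univ.filter fun p : Fin M × Fin M => p.2 < p.1).card :=
    Finset.card_bij (fun p _ => p.swap) (by simp) (by simp +contextual [Prod.ext_iff])
      (fun b hb => ⟨b.swap, by simpa using hb, by simp⟩)
  have h2 : (Finset.univ.filter fun p : Fin M × Fin M => p.1 < p.2) ∪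
      (Finset.univ.filter fun p : Fin M × Fin M => p.2 < p.1) = Finset.univ.offDiag := by
    ext p; simp [lt_or_lt_iff_ne]
  have h3 : Disjoint (Finset.univ.filter fun p : Fin M × Fin M => p.1 < p.2)
      (Finset.univ.filter fun p : Fin M × Fin M => p.2 < p.1) := by
    rw [Finset.disjoint_filter]; intro p _ h; exact h.le.not_gt
  have h4 := Finset.card_union_of_disjoint h3
  rw [h2, Finset.offDiag_card] at h4
  simp at h4
  rw [Nat.mul_sub, mul_one]
  omega

lemma bound_j {𝒳 : Type*} [Fintype 𝒳] [DecidableEq 𝒳] [MeasurableSpace 𝒳]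
    [MeasurableSingletonClass 𝒳]
    {M : ℕ} (hM : 2 ≤ M) (hM0 : 0 < M)
    (P : Fin M → 𝒳 → ℝ) (hP0 : ∀ i a, 0 ≤ P i a) (hP1 : ∀ i, ∑ a, P i a = 1)
    {n N : ℕ} (hn : 0 < n) (hN : 0 < N) (v ε δ B : ℝ) (hε : 0 ≤ ε) (hδ : 0 ≤ δ)
    (hed : ε + δ = v / 2)
    (hB1 : -2 * N * (2 * ε / Fintype.card 𝒳) ^ 2 = -B)
    (hB2 : -2 * n * δ ^ 2 = -B) (j : Fin M)
    (hsep : ∀ᵐ ω ∂((Measure.pi fun i => Measure.pi fun _ : Fin N => measOf (P i)).prod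
      ((Measure.dirac j).prod (Measure.pi fun _ : Fin n => measOf (P j)))),
      v ≤ minPairTV fun i => empDist (ω.1 i)) :
    ((Measure.pi fun i => Measure.pi fun _ : Fin N => measOf (P i)).prod
      ((Measure.dirac j).prod (Measure.pi fun _ : Fin n => measOf (P j)))) (errEvent hM0) ≤
      ENNReal.ofReal ((2 * Fintype.card 𝒳 + M * (M - 1)) * Real.exp (-B)) := by
  have hprob : ∀ i, IsProbabilityMeasure (measOf (P i)) := fun i => measOf_prob _ (hP0 i) (hP1 i)
  set τ : Measure (Fin M → Fin N → 𝒳) :=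
    Measure.pi fun i => Measure.pi fun _ : Fin N => measOf (P i) with hτ
  set π : Measure (Fin n → 𝒳) := Measure.pi fun _ : Fin n => measOf (P j) with hπ
  set ν := τ.prod ((Measure.dirac j).prod π) with hν
  let S1 : 𝒳 → Set ((Fin M → Fin N → 𝒳) × Fin M × (Fin n → 𝒳)) := fun a =>
    {ω | 2 * ε / Fintype.card 𝒳 ≤ |(∑ b ∈ {a}, empDist (ω.1 j) b) - ∑ b ∈ {a}, P j b|}
  let S2 : Fin M × Fin M → Set ((Fin M → Fin N → 𝒳) × Fin M × (Fin n → 𝒳)) := fun p =>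
    {ω | δ ≤ |(∑ a ∈ Finset.univ.filter fun a => empDist (ω.1 p.2) a ≤ empDist (ω.1 p.1) a,
            empDist ω.2.2 a) -
         (∑ a ∈ Finset.univ.filter fun a => empDist (ω.1 p.2) a ≤ empDist (ω.1 p.1) a, P j a)|}
  have hS1 : ∀ a, ν (S1 a) ≤ ENNReal.ofReal (2 * Real.exp (-B)) := fun a => by
    have h := hoeff (P j) (hP0 j) (hP1 j) hN {a} (2 * ε / Fintype.card 𝒳) (by positivity)
    rw [hB1] at h
    refine le_trans (le_of_eq ?_) h
    have m1 : MeasurePreserving (Prod.fst) ν τ := measurePreserving_fst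
    have m2 : MeasurePreserving (Function.eval j) τ (Measure.pi fun _ : Fin N => measOf (P j)) :=
      measurePreserving_eval (fun i => Measure.pi fun _ : Fin N => measOf (P i)) j
    exact (m2.comp m1).measure_preimage (s := {x : Fin N → 𝒳 | 2 * ε / Fintype.card 𝒳 ≤
      |(∑ b ∈ {a}, empDist x b) - ∑ b ∈ {a}, P j b|}) (meas_all _).nullMeasurableSet
  have hS2 : ∀ p, ν (S2 p) ≤ ENNReal.ofReal (2 * Real.exp (-B)) := fun p => by
    refine prod_le_const _ _ _ (meas_all _) _ fun t => ?_
    refine prod_le_const _ _ _ (meas_all _) _ fun i => ?_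
    have h := hoeff (P j) (hP0 j) (hP1 j) hn
      (Finset.univ.filter fun a => empDist (t p.2) a ≤ empDist (t p.1) a) δ hδ
    rw [hB2] at h
    exact h
  have hJ : ∀ᵐ ω ∂ν, ω.2.1 = j := by
    have m1 : MeasurePreserving (fun ω : (Fin M → Fin N → 𝒳) × Fin M × (Fin n → 𝒳) => ω.2.1)
        ν (Measure.dirac j) :=
      (measurePreserving_fst (μ := Measure.dirac j) (ν := π)).comp
        (measurePreserving_snd (μ := τ) (ν := (Measure.dirac j).prod π))
    exact m1.quasiMeasurePreserving.ae (p := fun i => i = j) (by simp [ae_dirac_eq])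
  have hle : ν (errEvent hM0) ≤ ν ((⋃ a ∈ (Finset.univ : Finset 𝒳), S1 a) ∪
      ⋃ p ∈ (Finset.univ.filter fun p : Fin M × Fin M => p.1 < p.2), S2 p) := by
    refine measure_mono_ae ?_
    filter_upwards [hJ, hsep] with ω h1 h2 h3
    have h3' : dglClassify hM0 (fun i => empDist (ω.1 i)) (empDist ω.2.2) ≠ j := by
      rw [← h1]; exact h3
    rcases err_imp hM hM0 (fun i => empDist (ω.1 i)) (fun i => sum_emp_univ hN _) (empDist ω.2.2) j
      (P j) (hP1 j) v ε δ h2 hed h3' with ⟨a, ha⟩ | ⟨p, q, hpq, h⟩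
    · left
      exact Set.mem_iUnion₂.mpr ⟨a, Finset.mem_univ _, ha⟩
    · right
      exact Set.mem_iUnion₂.mpr ⟨(p, q), by simpa using hpq, h⟩
  have hc : (2 : ℝ) * (Finset.univ.filter fun p : Fin M × Fin M => p.1 < p.2).card
      = M * (M - 1) := by
    have := card_lt_pairs M
    rw [← Nat.cast_pred hM0]
    exact_mod_cast this
  calc ν (errEvent hM0) ≤ _ := hle
    _ ≤ _ := measure_union_le _ _
    _ ≤ _ := add_le_add (measure_biUnion_finset_le _ _) (measure_biUnion_finset_le _ _)
    _ ≤ _ := add_le_add (Finset.sum_le_sum fun a _ => hS1 a) (Finset.sum_le_sum fun a _ => hS2 a)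
    _ = _ := by
      rw [Finset.sum_const, Finset.sum_const, ← ENNReal.ofReal_nsmul, ← ENNReal.ofReal_nsmul,
        ← ENNReal.ofReal_add (by positivity) (by positivity), nsmul_eq_mul, nsmul_eq_mul, ← hc,
        Finset.card_univ]
      congr 1; ring

theorem stmt_14 {𝒳 : Type*} [Fintype 𝒳] [DecidableEq 𝒳] [MeasurableSpace 𝒳]
    [MeasurableSingletonClass 𝒳]
    {M : ℕ} (hM : 2 ≤ M)
    (P : Fin M → 𝒳 → ℝ) (hP0 : ∀ i a, 0 ≤ P i a) (hP1 : ∀ i, ∑ a, P i a = 1)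
    {n N : ℕ} (hn : 0 < n) (hN : 0 < N) (α : ℝ) (hα : 0 < α)
    (hNnα : (N : ℝ) = n * α)
    (v : ℝ) (hv : 0 < v)
    (hsep : ∀ᵐ ω ∂(classMeasure (N := N) (n := n) P),
      v ≤ minPairTV fun i => empDist (ω.1 i)) :
    ((classMeasure (N := N) (n := n) P)
        (errEvent (𝒳 := 𝒳) (by omega : 0 < M))).toReal ≤
      2 * M * Real.exp (-(n : ℝ) *
        (2 * α * v ^ 2 / ((Fintype.card 𝒳 : ℝ) + 2 * Real.sqrt α) ^ 2 -
          max (2 * Real.log ((M : ℝ) - 1) / n)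
            (Real.log (Fintype.card 𝒳 : ℝ) / n))) := by
  have hM0 : 0 < M := by omega
  have hnR : (0 : ℝ) < n := by exact_mod_cast hn
  have hMR : (2 : ℝ) ≤ M := by exact_mod_cast hM
  have hne : Nonempty 𝒳 := by
    by_contra hne
    rw [not_nonempty_iff] at hne
    have := hP1 ⟨0, hM0⟩
    simp at this
  have hK1 : (1 : ℝ) ≤ Fintype.card 𝒳 := by exact_mod_cast Fintype.card_pos (α := 𝒳)
  set K : ℝ := (Fintype.card 𝒳 : ℝ) with hK
  set s := Real.sqrt α with hs
  have hs0 : 0 < s := Real.sqrt_pos.mpr hα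
  have hs2 : α = s ^ 2 := (Real.sq_sqrt hα.le).symm
  set E := 2 * α * v ^ 2 / (K + 2 * s) ^ 2 with hE
  have hD : 0 < K + 2 * s := by linarith
  unfold classMeasure at hsep
  rw [Measure.ae_ennreal_smul_measure_iff (by simp), ae_finsetSum_measure_iff] at hsep
  have key : ∀ j : Fin M, _ := fun j => bound_j hM hM0 P hP0 hP1 hn hN v
    (v * K / (2 * (K + 2 * s))) (v * s / (K + 2 * s)) (n * E) (by positivity) (by positivity)
    (by field_simp)
    (by rw [← hK, hNnα, hE, hs2]; field_simp)
    (by rw [hE, hs2]; field_simp) j (hsep j (Finset.mem_univ _))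
  have hexp : Real.exp (-(n : ℝ) * (E - max (2 * Real.log ((M : ℝ) - 1) / n) (Real.log K / n)))
      = Real.exp (-(n * E)) * max (((M : ℝ) - 1) ^ 2) K := by
    have h1 : -(n : ℝ) * (E - max (2 * Real.log ((M : ℝ) - 1) / n) (Real.log K / n))
        = -(n * E) + max (2 * Real.log ((M : ℝ) - 1)) (Real.log K) := by
      rw [max_div_div_right hnR.le]
      field_simp
      ring
    rw [h1, Real.exp_add, Real.exp_monotone.map_max, Real.exp_log (by linarith)]
    congr 2
    rw [two_mul, Real.exp_add, Real.exp_log (by linarith)]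
    ring
  rw [hexp]
  have hfin : (2 * K + M * (M - 1)) * Real.exp (-(n * E)) ≤
      2 * M * (Real.exp (-(n * E)) * max (((M : ℝ) - 1) ^ 2) K) := by
    have a1 := le_max_left (((M : ℝ) - 1) ^ 2) K
    have a2 := le_max_right (((M : ℝ) - 1) ^ 2) K
    set m := max (((M : ℝ) - 1) ^ 2) K
    have : 2 * K + M * (M - 1) ≤ 2 * M * m := by
      have b1 : (M : ℝ) - 1 ≤ m := by nlinarith
      have b2 : (M : ℝ) * (M - 1) ≤ M * m := by gcongr
      have b3 : 2 * K ≤ M * m := by gcongr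
      linarith
    calc _ ≤ (2 * M * m) * Real.exp (-(n * E)) := by gcongr
      _ = _ := by ring
  refine le_trans (ENNReal.toReal_le_of_le_ofReal ?_ ?_) hfin
  · have : (0 : ℝ) ≤ (M : ℝ) - 1 := by linarith
    positivity
  · unfold classMeasure
    rw [Measure.smul_apply, Measure.finsetSum_apply, smul_eq_mul]
    calc _ ≤ (M : ENNReal)⁻¹ * ∑ _j : Fin M,
          ENNReal.ofReal ((2 * K + M * (M - 1)) * Real.exp (-(n * E))) := by
          gcongr with j _
          exact key j
      _ = _ := by
        rw [Finset.sum_const, Finset.card_univ, Fintype.card_fin, nsmul_eq_mul, ← mul_assoc,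
          ENNReal.inv_mul_cancel (by positivity) (by simp), one_mul]
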